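/- arXiv:1408.1929 — 2 statements merged into one kernel-verified Lean document; each statement's English description precedes it below -/
import Mathlib

section
/- In the triangle configuration, the point P lies on segment MC and satisfies |MP|/|PC| = vu/(1+v) and |MP|/|MC| = vu/(1+v+vu). -/
/-- A point of a segment dividing it in the ratio `r` is the corresponding affine combination of
the endpoints. -/
theorem eq_lineMap_of_mem_segment_of_dist_eq {E : Type*} [NormedAddCommGroup E]
    [NormedSpace ℝ E] {A B X : E} {r : ℝ} (hr : 0 < r) (hX : X ∈ segment ℝ A B)
    (h : dist A X = r * dist X B) : X = AffineMap.lineMap A B (r / (1 + r)) := by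
  rw [segment_eq_image_lineMap] at hX
  obtain ⟨t, ⟨ht₀, ht₁⟩, rfl⟩ := hX
  rw [dist_left_lineMap, dist_lineMap_right, Real.norm_of_nonneg ht₀,
    Real.norm_of_nonneg (sub_nonneg.2 ht₁)] at h
  rcases eq_or_ne A B with rfl | hAB
  · simp
  · have hd : dist A B ≠ 0 := dist_ne_zero.2 hAB
    have ht : t = r * (1 - t) := mul_right_cancel₀ hd (by linarith)
    congr 1
    field_simp
    linarith

/-- In the triangle `ABC` with `M` on segment `AB` such that `|AM|/|MB| = v` and `K` on
segment `BC` such that `|BK|/|KC| = u`, the intersection point `P` of the lines `AK` and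
`CM` lies on segment `MC` and satisfies `|MP|/|PC| = vu/(1+v)` and
`|MP|/|MC| = vu/(1+v+vu)`. -/
theorem cevian_intersection_ratio'
    (A B C K M P : EuclideanSpace ℝ (Fin 2))
    (u v : ℝ) (hu : 0 < u) (hv : 0 < v)
    (hABC : AffineIndependent ℝ ![A, B, C])
    (hM : M ∈ segment ℝ A B) (hMr : dist A M = v * dist M B)
    (hK : K ∈ segment ℝ B C) (hKr : dist B K = u * dist K C)
    (hP₁ : P ∈ affineSpan ℝ ({A, K} : Set (EuclideanSpace ℝ (Fin 2))))
    (hP₂ : P ∈ affineSpan ℝ ({C, M} : Set (EuclideanSpace ℝ (Fin 2)))) :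
    P ∈ segment ℝ M C ∧
      dist M P = (v * u / (1 + v)) * dist P C ∧
      dist M P = (v * u / (1 + v + v * u)) * dist M C := by
  have hli : LinearIndependent ℝ ![B - A, C - A] := by
    have h := (affineIndependent_iff_linearIndependent_vsub ℝ ![A, B, C] 0).1 hABC
    have h' := h.comp (fun i : Fin 2 => ⟨i.succ, Fin.succ_ne_zero i⟩)
      (fun i j hij => Fin.succ_injective 2 (congrArg Subtype.val hij))
    have heq : ![B - A, C - A] = (fun i : {x : Fin 3 // x ≠ 0} =>
        ![A, B, C] i -ᵥ ![A, B, C] 0) ∘ fun i : Fin 2 => ⟨i.succ, Fin.succ_ne_zero i⟩ := by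
      funext i
      fin_cases i <;> rfl
    rw [heq]
    exact h'
  rw [LinearIndependent.pair_iff] at hli
  obtain rfl := eq_lineMap_of_mem_segment_of_dist_eq hv hM hMr
  obtain rfl := eq_lineMap_of_mem_segment_of_dist_eq hu hK hKr
  obtain ⟨s, hs⟩ := mem_affineSpan_pair_iff_exists_lineMap_eq.1 hP₁
  obtain ⟨t, rfl⟩ := mem_affineSpan_pair_iff_exists_lineMap_eq.1 hP₂
  have hcoef := hli (s / (1 + u) - t * v / (1 + v)) (s * u / (1 + u) - (1 - t)) (by
    rw [← sub_eq_zero] at hs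
    rw [← hs]
    simp only [AffineMap.lineMap_apply_module]
    match_scalars <;> field_simp <;> ring)
  obtain ⟨h₁, h₂⟩ := hcoef
  have hlin : t * v / (1 + v) * u = 1 - t := by
    have h₃ : s * u / (1 + u) = s / (1 + u) * u := by ring
    rw [← sub_eq_zero.1 h₁, ← h₃, sub_eq_zero.1 h₂]
  have hpos : 0 < 1 + v + v * u := by positivity
  have ht : t = (1 + v) / (1 + v + v * u) := by
    field_simp at hlin ⊢
    linarith
  have ht₀ : 0 ≤ t := by rw [ht]; positivity
  have ht' : 1 - t = v * u / (1 + v + v * u) := by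
    rw [ht]
    field_simp
    ring
  have ht₁ : 0 ≤ 1 - t := by rw [ht']; positivity
  refine ⟨?_, ?_, ?_⟩
  · rw [segment_symm, segment_eq_image_lineMap]
    exact ⟨t, ⟨ht₀, sub_nonneg.1 ht₁⟩, rfl⟩
  · rw [dist_right_lineMap, dist_lineMap_left, Real.norm_of_nonneg ht₁,
      Real.norm_of_nonneg ht₀, ht', ht]
    field_simp
  · rw [dist_right_lineMap, Real.norm_of_nonneg ht₁, ht', dist_comm C]
end

section
/- Let I be a nonempty proper subset of {1, …, n} and let ℬ(I) be the set of maximal blocks of cyclically consecutive indices (runs along the cycle (1 2 … n)) whose disjoint union is I. Then the volume of ∩_{i∈I} T_i equals (∏_{B∈ℬ(I)} V(B)) times the volume of S. -/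
open MeasureTheory Finset

/-- The closed half-space bounded by the hyperplane spanned by the set `s` and containing
the point `A`: all points `P` such that every affine functional vanishing on `s` which is
nonnegative at `A` is also nonnegative at `P`. -/
def closedHalfspace {V : Type*} [NormedAddCommGroup V] [NormedSpace ℝ V]
    (s : Set V) (A : V) : Set V :=
  {P | ∀ f : V →ᵃ[ℝ] ℝ, (∀ Q ∈ s, f Q = 0) → 0 ≤ f A → 0 ≤ f P}

/-- `T_i = H_i ∩ S`, where `H_i` is the closed half-space bounded by the hyperplane `σ_i`
through `A^0_1, …, A^0_{i-1}, A^1_i, A^0_{i+2}, …, A^0_n` containing `A^0_i`, and `S` is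
the simplex `A^0_1 … A^0_n`. -/
def routhPiece {n : ℕ} [NeZero n] (A : ℕ → ZMod n → EuclideanSpace ℝ (Fin (n - 1)))
    (i : ZMod n) : Set (EuclideanSpace ℝ (Fin (n - 1))) :=
  closedHalfspace ({A 1 i} ∪ (A 0) '' {m | m ≠ i ∧ m ≠ i + 1}) (A 0 i) ∩
    convexHull ℝ (Set.range (A 0))

/-- `V(B)` for a block `B = {k, k+1, …, k+l}` of consecutive indices mod `n`:
`V(B) = ∏_{j=k}^{k+l} (∏_{a=k}^{j} x_a) / (1 + Σ_{b=k}^{j} ∏_{a=k}^{b} x_a)`. -/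
noncomputable def routhBlockValue {n : ℕ} [NeZero n] (x : ZMod n → ℝ) (k : ZMod n)
    (l : ℕ) : ℝ :=
  ∏ j ∈ Finset.range (l + 1),
    (∏ a ∈ Finset.range (j + 1), x (k + (a : ZMod n))) /
      (1 + ∑ b ∈ Finset.range (j + 1), ∏ a ∈ Finset.range (b + 1), x (k + (a : ZMod n)))

/-- The length (number of elements minus one) of the maximal block of cyclically
consecutive elements of `I` starting at `k`. -/
noncomputable def routhBlockLen {n : ℕ} [NeZero n] (I : Finset (ZMod n)) (k : ZMod n) :
    ℕ :=
  sSup {l : ℕ | ∀ a ≤ l, k + (a : ZMod n) ∈ I}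

/-- The product `∏_{B ∈ ℬ(I)} V(B)` over the maximal blocks of cyclically consecutive
indices whose disjoint union is `I`: each block is recorded by its starting point `k`
(an element of `I` with `k - 1 ∉ I`) together with its length. -/
noncomputable def routhBlocksProd {n : ℕ} [NeZero n] (x : ZMod n → ℝ)
    (I : Finset (ZMod n)) : ℝ :=
  ∏ k ∈ I.filter (fun k => k - 1 ∉ I), routhBlockValue x k (routhBlockLen I k)

/-- The part of the simplex spanned by `b` cut out by the inequalities
`t (j + 1) ≤ x j * t j`, `j ∈ J`, on the barycentric coordinates `t`. -/
def ratioRegion {n : ℕ} {V : Type*} [NormedAddCommGroup V] [NormedSpace ℝ V]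
    (b : AffineBasis (ZMod n) ℝ V) (x : ZMod n → ℝ) (J : Finset (ZMod n)) : Set V :=
  {P | (∀ j, 0 ≤ b.coord j P) ∧ ∀ j ∈ J, b.coord (j + 1) P ≤ x j * b.coord j P}

lemma AffineBasis.coord_add_smul_sub {ι V : Type*} [NormedAddCommGroup V] [NormedSpace ℝ V]
    (b : AffineBasis ι ℝ V) (j : ι) (P Q R : V) (c : ℝ) :
    b.coord j (P + c • (Q - R)) = b.coord j P + c * (b.coord j Q - b.coord j R) := by
  have h := (b.coord j).map_vadd P (c • (Q - R))
  have h' := (b.coord j).linearMap_vsub Q R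
  simp only [vsub_eq_sub, vadd_eq_add, map_smul, smul_eq_mul] at h h'
  rw [add_comm P, h, h', add_comm]

lemma AffineBasis.volume_preimage_add_coord_smul {ι V : Type*} [NormedAddCommGroup V]
    [NormedSpace ℝ V] [MeasurableSpace V] [BorelSpace V] [FiniteDimensional ℝ V]
    (μ : Measure V) [μ.IsAddHaarMeasure] (b : AffineBasis ι ℝ V) (i : ι) (W : V)
    (hW : 0 < b.coord i W) (s : Set V) :
    μ s = ENNReal.ofReal (b.coord i W) *
      μ ((fun P => P + b.coord i P • (W - b i)) ⁻¹' s) := by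
  set f : Module.Dual ℝ V := (b.coord i).linear
  set v := W - b i with hv
  set L := LinearMap.transvection f v
  have hdet : LinearMap.det L = b.coord i W := by
    have h' := (b.coord i).linearMap_vsub W (b i)
    simp only [vsub_eq_sub, b.coord_apply_eq] at h'
    rw [LinearMap.transvection.det, hv]
    simp only [f, h']
    ring
  have hpre : (fun P => P + b.coord i P • v) ⁻¹' s =
      L ⁻¹' ((fun P => P + b.coord i 0 • v) ⁻¹' s) := by
    ext P
    have h := (b.coord i).map_vadd 0 P
    simp only [vadd_eq_add, add_zero] at h
    simp only [Set.mem_preimage, L, LinearMap.transvection.apply, h, f, add_smul, add_assoc]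
  rw [hpre, Measure.addHaar_preimage_linearMap μ (by rw [hdet]; exact hW.ne'), hdet,
    measure_preimage_add_right, ← mul_assoc, ← ENNReal.ofReal_mul hW.le,
    abs_of_pos (inv_pos.2 hW), mul_inv_cancel₀ hW.ne', ENNReal.ofReal_one, one_mul]

lemma volume_ratioRegion_insert {n : ℕ} [NeZero n] {V : Type*} [NormedAddCommGroup V]
    [NormedSpace ℝ V] [MeasurableSpace V] [BorelSpace V] [FiniteDimensional ℝ V]
    (μ : Measure V) [μ.IsAddHaarMeasure] (b : AffineBasis (ZMod n) ℝ V)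
    {x : ZMod n → ℝ} (hx : ∀ i, 0 < x i) {J : Finset (ZMod n)} {i : ZMod n}
    (hne : i ≠ i + 1) (hi : i ∉ J) (hi' : i + 1 ∉ J)
    {w : ZMod n → ℝ} (hw : ∀ j, 0 ≤ w j) (hsum : ∑ j, w j = 1) (hpos : 0 < w (i + 1))
    (hrec : ∀ j ∈ insert i J, w (j + 1) = x j * w j)
    (hback : ∀ t : ZMod n → ℝ, 0 ≤ t i → (∀ j ∈ J, t (j + 1) ≤ x j * t j) →
      ∀ j ≠ i + 1, w j ≠ 0 → 0 ≤ t j) :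
    μ (ratioRegion b x (insert i J)) =
      ENNReal.ofReal (w (i + 1)) * μ (ratioRegion b x J) := by
  set W := Finset.univ.affineCombination ℝ b w
  have hW : ∀ j, b.coord j W = w j := fun j =>
    b.coord_apply_combination_of_mem (Finset.mem_univ j) hsum
  have key := b.volume_preimage_add_coord_smul μ (i + 1) W (by rwa [hW])
    (ratioRegion b x (insert i J))
  rw [hW] at key
  rw [key]
  congr 2
  ext P
  set t : ZMod n → ℝ := fun j => b.coord j P with ht
  have hc1 : b.coord (i + 1) (P + b.coord (i + 1) P • (W - b (i + 1))) =
      w (i + 1) * t (i + 1) := by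
    rw [b.coord_add_smul_sub, hW, b.coord_apply_eq]; simp only [ht]; ring
  have hc : ∀ j ≠ i + 1, b.coord j (P + b.coord (i + 1) P • (W - b (i + 1))) =
      t j + t (i + 1) * w j := by
    intro j hj
    rw [b.coord_add_smul_sub, hW, b.coord_apply_ne hj]; simp only [ht]; ring
  have hJ : ∀ j ∈ J, j ≠ i + 1 ∧ j + 1 ≠ i + 1 := fun j hj =>
    ⟨fun h => hi' (h ▸ hj), fun h => hi (add_right_cancel h ▸ hj)⟩
  have hreci := hrec i (Finset.mem_insert_self _ _)
  simp only [Set.mem_preimage, ratioRegion, Set.mem_ofPred_eq]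
  change _ ↔ (∀ j, 0 ≤ t j) ∧ ∀ j ∈ J, t (j + 1) ≤ x j * t j
  constructor
  · rintro ⟨h0, h1⟩
    have hJt : ∀ j ∈ J, t (j + 1) ≤ x j * t j := by
      intro j hj
      have := h1 j (Finset.mem_insert_of_mem hj)
      rw [hc _ (hJ j hj).1, hc _ (hJ j hj).2, hrec j (Finset.mem_insert_of_mem hj)] at this
      linarith
    have hti : 0 ≤ t i := by
      have := h1 i (Finset.mem_insert_self _ _)
      rw [hc1, hc _ hne, hreci] at this
      exact nonneg_of_mul_nonneg_right (by linarith : 0 ≤ x i * t i) (hx i)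
    refine ⟨fun j => ?_, hJt⟩
    by_cases hj : j = i + 1
    · have := h0 (i + 1)
      rw [hc1] at this
      exact hj ▸ nonneg_of_mul_nonneg_right this hpos
    by_cases hwj : w j = 0
    · have := h0 j
      rwa [hc j hj, hwj, mul_zero, add_zero] at this
    · exact hback t hti hJt j hj hwj
  · rintro ⟨h0, h1⟩
    refine ⟨fun j => ?_, fun j hj => ?_⟩
    · by_cases hj : j = i + 1
      · rw [hj, hc1]; exact mul_nonneg hpos.le (h0 _)
      · rw [hc j hj]; exact add_nonneg (h0 _) (mul_nonneg (h0 _) (hw _))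
    · rcases Finset.mem_insert.1 hj with rfl | hj'
      · rw [hc1, hc _ hne, hreci]
        have := mul_nonneg (hx j).le (h0 j)
        linarith
      · rw [hc _ (hJ j hj').1, hc _ (hJ j hj').2, hrec j hj]
        linarith [h1 j hj']

lemma ZMod.sum_val_sub {n : ℕ} [NeZero n] (k : ZMod n) (g : ℕ → ℝ) :
    ∑ j : ZMod n, g (j - k).val = ∑ a ∈ Finset.range n, g a := by
  refine Finset.sum_bij' (fun j _ => (j - k).val) (fun a _ => k + (a : ZMod n)) ?_ ?_ ?_ ?_ ?_
  · intro j _; exact Finset.mem_range.2 (ZMod.val_lt _)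
  · intro a _; exact Finset.mem_univ _
  · intro j _; simp
  · intro a ha; simp [ZMod.val_natCast_of_lt (Finset.mem_range.1 ha)]
  · intro j _; rfl

lemma ZMod.exists_eq_add_natCast {n : ℕ} [NeZero n] (k j : ZMod n) :
    ∃ a < n, j = k + (a : ZMod n) :=
  ⟨(j - k).val, ZMod.val_lt _, by simp⟩

lemma ZMod.add_natCast_inj {n : ℕ} [NeZero n] {k : ZMod n} {a c : ℕ} (ha : a < n) (hc : c < n)
    (h : k + (a : ZMod n) = k + (c : ZMod n)) : a = c := by
  have := congrArg ZMod.val (add_left_cancel h)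
  rwa [ZMod.val_natCast_of_lt ha, ZMod.val_natCast_of_lt hc] at this

/-- The `m` cyclically consecutive indices starting at `k`. -/
def cyclicRun {n : ℕ} (k : ZMod n) (m : ℕ) : Finset (ZMod n) :=
  (Finset.range m).image fun a : ℕ => k + (a : ZMod n)

lemma mem_cyclicRun {n : ℕ} {k j : ZMod n} {m : ℕ} :
    j ∈ cyclicRun k m ↔ ∃ a < m, k + (a : ZMod n) = j := by
  simp [cyclicRun]

lemma cyclicRun_succ {n : ℕ} (k : ZMod n) (m : ℕ) :
    cyclicRun k (m + 1) = insert (k + (m : ZMod n)) (cyclicRun k m) := by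
  simp [cyclicRun, Finset.range_add_one, Finset.image_insert]

lemma volume_ratioRegion_union_cyclicRun_succ {n : ℕ} [NeZero n] {V : Type*}
    [NormedAddCommGroup V] [NormedSpace ℝ V] [MeasurableSpace V] [BorelSpace V]
    [FiniteDimensional ℝ V] (μ : Measure V) [μ.IsAddHaarMeasure] (b : AffineBasis (ZMod n) ℝ V)
    {x : ZMod n → ℝ} (hx : ∀ i, 0 < x i) {U : Finset (ZMod n)} {k : ZMod n} {m : ℕ}
    (hm : m + 1 < n) (hk : k - 1 ∉ U) (hU : ∀ a ≤ m + 1, k + (a : ZMod n) ∉ U) :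
    μ (ratioRegion b x (U ∪ cyclicRun k (m + 1))) =
      ENNReal.ofReal ((∏ a ∈ Finset.range (m + 1), x (k + (a : ZMod n))) /
        (1 + ∑ c ∈ Finset.range (m + 1), ∏ a ∈ Finset.range (c + 1), x (k + (a : ZMod n)))) *
      μ (ratioRegion b x (U ∪ cyclicRun k m)) := by
  set p : ℕ → ℝ := fun c => ∏ a ∈ Finset.range c, x (k + (a : ZMod n)) with hp
  have hp0 : ∀ c, 0 < p c := fun c => Finset.prod_pos fun a _ => hx _
  have hD : (1 + ∑ c ∈ Finset.range (m + 1), p (c + 1)) =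
      ∑ c ∈ Finset.range (m + 2), p c := by
    rw [Finset.sum_range_succ' _ (m + 1), add_comm]; simp [hp]
  change _ = ENNReal.ofReal (p (m + 1) / (1 + ∑ c ∈ Finset.range (m + 1), p (c + 1))) * _
  rw [hD]
  set D := ∑ c ∈ Finset.range (m + 2), p c with hDdef
  have hD0 : 0 < D := Finset.sum_pos (fun c _ => hp0 c) ⟨0, by simp⟩
  set g : ℕ → ℝ := fun a => if a ≤ m + 1 then p a / D else 0 with hg
  set w : ZMod n → ℝ := fun j => g (j - k).val with hwdef
  have hwk : ∀ a < n, w (k + (a : ZMod n)) = g a := by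
    intro a ha
    simp [hwdef, ZMod.val_natCast_of_lt ha]
  have hsucc : ∀ a : ℕ, k + (a : ZMod n) + 1 = k + ((a + 1 : ℕ) : ZMod n) := by
    intro a; push_cast; ring
  have hlast : w (k + (m : ZMod n) + 1) = p (m + 1) / D := by
    rw [hsucc, hwk _ hm]; simp [hg]
  rw [cyclicRun_succ, Finset.union_insert, ← hlast]
  have hkn : k + ((n - 1 : ℕ) : ZMod n) = k - 1 := by
    rw [Nat.cast_sub (by omega)]; simp [sub_eq_add_neg]
  apply volume_ratioRegion_insert μ b hx
  · rw [hsucc]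
    intro h
    have := ZMod.add_natCast_inj (by omega) hm h
    omega
  · rw [Finset.mem_union, mem_cyclicRun]
    rintro (h | ⟨a, ha, h⟩)
    · exact hU m (by omega) h
    · have := ZMod.add_natCast_inj (by omega) (by omega) h
      omega
  · rw [hsucc, Finset.mem_union, mem_cyclicRun]
    rintro (h | ⟨a, ha, h⟩)
    · exact hU (m + 1) le_rfl h
    · have := ZMod.add_natCast_inj (by omega) (by omega) h
      omega
  · intro j
    simp only [hwdef, hg]
    split_ifs
    · exact (div_pos (hp0 _) hD0).le
    · exact le_rfl
  · simp only [hwdef]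
    rw [ZMod.sum_val_sub k g,
      ← Finset.sum_subset (Finset.range_subset_range.2 (by omega : m + 2 ≤ n))]
    · rw [Finset.sum_congr rfl (g := fun c => p c / D), ← Finset.sum_div, div_self hD0.ne']
      intro c hc
      simp only [hg]
      rw [if_pos (by have := Finset.mem_range.1 hc; omega)]
    · intro c _ hc
      simp only [hg]
      rw [if_neg (by have := mt Finset.mem_range.2 hc; omega)]
  · rw [hlast]; exact div_pos (hp0 _) hD0
  · have hrun : ∀ a ≤ m,
        w (k + (a : ZMod n) + 1) = x (k + (a : ZMod n)) * w (k + (a : ZMod n)) := by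
      intro a ha
      rw [hsucc, hwk _ (by omega), hwk _ (by omega)]
      simp only [hg]
      rw [if_pos (by omega), if_pos (by omega)]
      simp only [hp, Finset.prod_range_succ]
      ring
    intro j hj
    rw [Finset.mem_insert, Finset.mem_union, mem_cyclicRun] at hj
    rcases hj with rfl | hj | ⟨a, ha, rfl⟩
    · exact hrun m le_rfl
    · obtain ⟨a, ha, rfl⟩ := ZMod.exists_eq_add_natCast k j
      have h1 : m + 1 < a := by
        by_contra h
        exact hU a (by omega) hj
      have h2 : a + 1 < n := by
        by_contra h
        obtain rfl : a = n - 1 := by omega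
        exact hk (hkn ▸ hj)
      rw [hsucc, hwk _ (by omega), hwk _ (by omega)]
      simp only [hg]
      rw [if_neg (by omega), if_neg (by omega), mul_zero]
    · exact hrun a ha.le
  · intro t ht hJ j hj hwj
    obtain ⟨a, ha, rfl⟩ := ZMod.exists_eq_add_natCast k j
    have ham : a ≤ m := by
      by_contra h
      rw [hwk a ha] at hwj
      by_cases h' : a = m + 1
      · exact hj (by rw [hsucc, h'])
      · exact hwj (by simp only [hg]; rw [if_neg (by omega)])
    clear hj hwj ha
    induction ham using Nat.decreasingInduction with
    | self => exact ht
    | of_succ c hc ih =>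
      have := hJ (k + (c : ZMod n))
        (Finset.mem_union_right _ (mem_cyclicRun.2 ⟨c, hc, rfl⟩))
      rw [hsucc] at this
      exact nonneg_of_mul_nonneg_right (ih.trans this) (hx _)

lemma routhBlockValue_nonneg {n : ℕ} [NeZero n] {x : ZMod n → ℝ} (hx : ∀ i, 0 < x i)
    (k : ZMod n) (l : ℕ) : 0 ≤ routhBlockValue x k l := by
  refine Finset.prod_nonneg fun j _ => ?_
  refine div_nonneg (Finset.prod_nonneg fun a _ => (hx _).le) (add_nonneg zero_le_one ?_)
  exact Finset.sum_nonneg fun c _ => Finset.prod_nonneg fun a _ => (hx _).le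

lemma volume_ratioRegion_union_cyclicRun {n : ℕ} [NeZero n] {V : Type*}
    [NormedAddCommGroup V] [NormedSpace ℝ V] [MeasurableSpace V] [BorelSpace V]
    [FiniteDimensional ℝ V] (μ : Measure V) [μ.IsAddHaarMeasure] (b : AffineBasis (ZMod n) ℝ V)
    {x : ZMod n → ℝ} (hx : ∀ i, 0 < x i) {U : Finset (ZMod n)} {k : ZMod n} {l : ℕ}
    (hl : l + 1 < n) (hk : k - 1 ∉ U) (hU : ∀ a ≤ l + 1, k + (a : ZMod n) ∉ U) :
    μ (ratioRegion b x (U ∪ cyclicRun k (l + 1))) =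
      ENNReal.ofReal (routhBlockValue x k l) * μ (ratioRegion b x U) := by
  induction l with
  | zero =>
    have h := volume_ratioRegion_union_cyclicRun_succ μ b hx hl hk hU
    simpa [routhBlockValue, cyclicRun] using h
  | succ l ih =>
    have h : routhBlockValue x k (l + 1) = routhBlockValue x k l * _ :=
      Finset.prod_range_succ _ (l + 1)
    rw [h, volume_ratioRegion_union_cyclicRun_succ μ b hx hl hk hU,
      ih (by omega) (fun a ha => hU a (by omega)), ← mul_assoc, mul_comm (ENNReal.ofReal _),
      ← ENNReal.ofReal_mul (routhBlockValue_nonneg hx k l)]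

lemma routhBlockLen_spec {n : ℕ} [NeZero n] {I : Finset (ZMod n)} {k : ZMod n}
    (hI : I ≠ Finset.univ) (hk : k ∈ I) :
    (∀ a ≤ routhBlockLen I k, k + (a : ZMod n) ∈ I) ∧
      k + ((routhBlockLen I k + 1 : ℕ) : ZMod n) ∉ I := by
  set S := {l : ℕ | ∀ a ≤ l, k + (a : ZMod n) ∈ I} with hS
  have hne : S.Nonempty := ⟨0, by simpa [hS] using hk⟩
  have hbdd : BddAbove S := by
    refine ⟨n, fun l hl => ?_⟩
    by_contra h
    refine hI (Finset.eq_univ_iff_forall.2 fun j => ?_)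
    obtain ⟨a, ha, rfl⟩ := ZMod.exists_eq_add_natCast k j
    exact hl a (by omega)
  have hmem : routhBlockLen I k ∈ S := Nat.sSup_mem hne hbdd
  refine ⟨hmem, fun h => ?_⟩
  have : routhBlockLen I k + 1 ∈ S := by
    intro a ha
    rcases Nat.le_succ_iff.1 ha with ha | rfl
    · exact hmem a ha
    · exact h
  have : routhBlockLen I k + 1 ≤ routhBlockLen I k := le_csSup hbdd this
  omega

lemma add_natCast_ne_of_block_starts {n : ℕ} {I : Finset (ZMod n)} {k k' : ZMod n}
    (hk : k - 1 ∉ I) {a c : ℕ} (hac : a ≤ c)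
    (hc : ∀ d ≤ c, k' + (d : ZMod n) ∈ I) (hne : k ≠ k') :
    k + (a : ZMod n) ≠ k' + (c : ZMod n) := by
  intro h
  obtain ⟨d, rfl⟩ := Nat.exists_eq_add_of_le hac
  rcases d with _ | d
  · exact hne (add_right_cancel h)
  · refine hk ?_
    have : k - 1 = k' + (d : ZMod n) := by
      push_cast at h
      linear_combination h
    exact this ▸ hc d (by omega)

lemma exists_block_start {n : ℕ} [NeZero n] {I : Finset (ZMod n)} {j : ZMod n}
    (hI : I ≠ Finset.univ) (hj : j ∈ I) :
    ∃ k ∈ I, k - 1 ∉ I ∧ j ∈ cyclicRun k (routhBlockLen I k + 1) := by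
  classical
  obtain ⟨c, hc⟩ : ∃ c, c ∉ I := by
    by_contra! h
    exact hI (Finset.eq_univ_iff_forall.2 h)
  have hex : ∃ d : ℕ, j - (d : ZMod n) ∉ I := ⟨(j - c).val, by simpa using hc⟩
  have hspec := Nat.find_spec hex
  have hmin : ∀ d < Nat.find hex, j - (d : ZMod n) ∈ I := fun d hd =>
    not_not.1 (Nat.find_min hex hd)
  obtain ⟨e, he⟩ : ∃ e, Nat.find hex = e + 1 := by
    refine Nat.exists_eq_succ_of_ne_zero fun h => ?_
    rw [h] at hspec
    simp [hj] at hspec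
  rw [he] at hspec hmin
  have hk : j - (e : ZMod n) ∈ I := hmin e (by omega)
  refine ⟨j - (e : ZMod n), hk, ?_, mem_cyclicRun.2 ⟨e, ?_, by ring⟩⟩
  · rwa [sub_sub, ← Nat.cast_succ]
  · by_contra! h
    refine (routhBlockLen_spec hI hk).2 ?_
    have := hmin (e - (routhBlockLen I (j - (e : ZMod n)) + 1)) (by omega)
    rw [Nat.cast_sub h] at this
    convert this using 1
    ring

lemma biUnion_cyclicRun {n : ℕ} [NeZero n] {I : Finset (ZMod n)} (hI : I ≠ Finset.univ) :
    (I.filter fun k => k - 1 ∉ I).biUnion (fun k => cyclicRun k (routhBlockLen I k + 1)) = I := by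
  ext j
  simp only [Finset.mem_biUnion, Finset.mem_filter]
  constructor
  · rintro ⟨k, ⟨hk, -⟩, hj⟩
    obtain ⟨a, ha, rfl⟩ := mem_cyclicRun.1 hj
    exact (routhBlockLen_spec hI hk).1 a (by omega)
  · intro hj
    obtain ⟨k, hk, hk', h⟩ := exists_block_start hI hj
    exact ⟨k, ⟨hk, hk'⟩, h⟩

lemma routhBlockLen_succ_lt {n : ℕ} [NeZero n] {I : Finset (ZMod n)} {k : ZMod n}
    (hI : I ≠ Finset.univ) (hk : k ∈ I) (hk' : k - 1 ∉ I) :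
    routhBlockLen I k + 1 < n := by
  have hn := NeZero.pos n
  by_contra h
  refine hk' ?_
  have := (routhBlockLen_spec hI hk).1 (n - 1) (by omega)
  rw [Nat.cast_sub (by omega)] at this
  simpa [sub_eq_add_neg] using this

lemma volume_ratioRegion {n : ℕ} [NeZero n] {V : Type*}
    [NormedAddCommGroup V] [NormedSpace ℝ V] [MeasurableSpace V] [BorelSpace V]
    [FiniteDimensional ℝ V] (μ : Measure V) [μ.IsAddHaarMeasure] (b : AffineBasis (ZMod n) ℝ V)
    {x : ZMod n → ℝ} (hx : ∀ i, 0 < x i) {I : Finset (ZMod n)} (hI : I ≠ Finset.univ) :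
    μ (ratioRegion b x I) = ENNReal.ofReal (routhBlocksProd x I) * μ (ratioRegion b x ∅) := by
  have h : ∀ K ⊆ I.filter (fun k => k - 1 ∉ I),
      μ (ratioRegion b x (K.biUnion fun k => cyclicRun k (routhBlockLen I k + 1))) =
        ENNReal.ofReal (∏ k ∈ K, routhBlockValue x k (routhBlockLen I k)) *
          μ (ratioRegion b x ∅) := by
    intro K
    induction K using Finset.induction_on with
    | empty => intro _; simp
    | insert k K hkK ih =>
      intro hK
      obtain ⟨hkI, hk⟩ := Finset.mem_filter.1 (hK (Finset.mem_insert_self k K))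
      have hK' : ∀ k' ∈ K, k' ∈ I ∧ k' - 1 ∉ I := fun k' h =>
        Finset.mem_filter.1 (hK (Finset.mem_insert_of_mem h))
      have hsub : ∀ j ∈ K.biUnion (fun k => cyclicRun k (routhBlockLen I k + 1)), j ∈ I := by
        intro j hj
        rw [← biUnion_cyclicRun hI]
        exact Finset.biUnion_subset_biUnion_of_subset_left _
          ((Finset.subset_insert k K).trans hK) hj
      rw [Finset.biUnion_insert, Finset.union_comm, Finset.prod_insert hkK,
        ENNReal.ofReal_mul (routhBlockValue_nonneg hx _ _), mul_assoc,
        ← ih ((Finset.subset_insert k K).trans hK)]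
      refine volume_ratioRegion_union_cyclicRun μ b hx (routhBlockLen_succ_lt hI hkI hk)
        (fun h => hk (hsub _ h)) fun a ha hmem => ?_
      obtain ⟨hlen, hend⟩ := routhBlockLen_spec hI hkI
      rcases Nat.le_succ_iff.1 ha with ha | rfl
      · obtain ⟨k', hk', hmem⟩ := Finset.mem_biUnion.1 hmem
        obtain ⟨c, hc, h⟩ := mem_cyclicRun.1 hmem
        have hne : k' ≠ k := fun h => hkK (h ▸ hk')
        rcases le_total a c with hac | hac
        · exact add_natCast_ne_of_block_starts hk hac
            (fun d hd => (routhBlockLen_spec hI (hK' k' hk').1).1 d (by omega)) hne.symm h.symm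
        · exact add_natCast_ne_of_block_starts (hK' k' hk').2 hac
            (fun d hd => hlen d (by omega)) hne h
      · exact hend (hsub _ hmem)
  have := h _ subset_rfl
  rwa [biUnion_cyclicRun hI] at this

lemma eq_lineMap_of_dist_ratio {V : Type*} [NormedAddCommGroup V] [NormedSpace ℝ V]
    {P Q R : V} {r : ℝ} (hr : 0 < r) (hPR : P ≠ R) (hQ : Q ∈ segment ℝ P R)
    (hdist : dist P Q = r * dist Q R) : Q = AffineMap.lineMap P R (r / (1 + r)) := by
  rw [segment_eq_image_lineMap] at hQ
  obtain ⟨c, ⟨hc0, hc1⟩, rfl⟩ := hQ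
  rw [dist_left_lineMap, dist_lineMap_right, Real.norm_of_nonneg hc0,
    Real.norm_of_nonneg (by linarith), ← mul_assoc] at hdist
  have := mul_right_cancel₀ (dist_ne_zero.2 hPR) hdist
  congr 1
  rw [eq_div_iff (by positivity)]
  linarith

lemma mem_closedHalfspace_iff {n : ℕ} [NeZero n] {V : Type*} [NormedAddCommGroup V]
    [NormedSpace ℝ V] (b : AffineBasis (ZMod n) ℝ V) {i : ZMod n} (hne : i ≠ i + 1)
    {r : ℝ} (hr : 0 < r) (P : V) :
    P ∈ closedHalfspace ({AffineMap.lineMap (b i) (b (i + 1)) (r / (1 + r))} ∪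
        b '' {m | m ≠ i ∧ m ≠ i + 1}) (b i) ↔
      b.coord (i + 1) P ≤ r * b.coord i P := by
  set g : V →ᵃ[ℝ] ℝ := r • b.coord i - b.coord (i + 1) with hg
  have hgP : ∀ P, g P = r * b.coord i P - b.coord (i + 1) P := fun P => by simp [hg]
  have hgi : g (b i) = r := by simp [hgP, b.coord_apply_ne hne.symm]
  have hgi' : g (b (i + 1)) = -1 := by simp [hgP, b.coord_apply_ne hne]
  rw [closedHalfspace, Set.mem_ofPred_eq]
  constructor
  · intro h
    have := h g ?_ (by rw [hgi]; exact hr.le)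
    · rw [hgP] at this; linarith
    rintro Q (rfl | ⟨m, ⟨h1, h2⟩, rfl⟩)
    · rw [AffineMap.apply_lineMap, hgi, hgi', AffineMap.lineMap_apply_ring']
      field_simp
      ring
    · rw [hgP, b.coord_apply_ne h1.symm, b.coord_apply_ne h2.symm]; ring
  · intro hP f hf hfi
    have hlm := hf _ (Or.inl rfl)
    rw [AffineMap.apply_lineMap, AffineMap.lineMap_apply_ring'] at hlm
    have hfg : f = (f (b i) / r) • g := by
      refine AffineMap.ext_on b.tot ?_
      rintro _ ⟨m, rfl⟩
      rw [AffineMap.coe_smul, Pi.smul_apply, smul_eq_mul]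
      by_cases h1 : m = i
      · rw [h1, hgi]; field_simp
      by_cases h2 : m = i + 1
      · rw [h2, hgi']
        field_simp at hlm ⊢
        linarith
      · rw [hf _ (Or.inr ⟨m, ⟨h1, h2⟩, rfl⟩), hgP, b.coord_apply_ne (Ne.symm h1),
          b.coord_apply_ne (Ne.symm h2)]
        ring
    rw [hfg, AffineMap.coe_smul, Pi.smul_apply, smul_eq_mul, hgP]
    exact mul_nonneg (div_nonneg hfi hr.le) (by linarith)

/-- **Proposition 2 of the paper.** For a nonempty proper subset `I` of the index set,
the volume of `∩_{i∈I} T_i` equals `∏_{B∈ℬ(I)} V(B)` times the volume of `S`. -/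
theorem routh_simplex_blocks
    (n : ℕ) [NeZero n] (hn : 4 ≤ n)
    (A : ℕ → ZMod n → EuclideanSpace ℝ (Fin (n - 1)))
    (x : ZMod n → ℝ) (hx : ∀ i, 0 < x i)
    (hind : AffineIndependent ℝ (A 0))
    (hseg : ∀ i, A 1 i ∈ segment ℝ (A 0 i) (A 0 (i + 1)))
    (hratio : ∀ i, dist (A 0 i) (A 1 i) = x i * dist (A 1 i) (A 0 (i + 1)))
    (I : Finset (ZMod n)) (hI : I.Nonempty) (hI' : I ≠ Finset.univ) :
    volume (⋂ i ∈ I, routhPiece A i) =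
      ENNReal.ofReal (routhBlocksProd x I) *
        volume (convexHull ℝ (Set.range (A 0))) := by
  have htop : affineSpan ℝ (Set.range (A 0)) = ⊤ := by
    rw [hind.affineSpan_eq_top_iff_card_eq_finrank_add_one, ZMod.card, finrank_euclideanSpace,
      Fintype.card_fin]
    omega
  set b : AffineBasis (ZMod n) ℝ (EuclideanSpace ℝ (Fin (n - 1))) := ⟨A 0, hind, htop⟩
  have hne : ∀ i : ZMod n, i ≠ i + 1 := by
    have : Fact (1 < n) := ⟨by omega⟩
    intro i
    simp
  have hS : convexHull ℝ (Set.range (A 0)) = ratioRegion b x ∅ := by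
    rw [show A 0 = b from rfl, b.convexHull_eq_nonneg_coord]
    simp [ratioRegion]
  have hT : ∀ i P, P ∈ routhPiece A i ↔ (b.coord (i + 1) P ≤ x i * b.coord i P) ∧
      ∀ j, 0 ≤ b.coord j P := by
    intro i P
    have hA := eq_lineMap_of_dist_ratio (hx i) (hind.injective.ne (hne i)) (hseg i) (hratio i)
    rw [routhPiece, Set.mem_inter_iff, hA, show A 0 = b from rfl,
      mem_closedHalfspace_iff b (hne i) (hx i), b.convexHull_eq_nonneg_coord, Set.mem_ofPred_eq]
  have hinter : ⋂ i ∈ I, routhPiece A i = ratioRegion b x I := by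
    ext P
    simp only [Set.mem_iInter, hT, ratioRegion, Set.mem_ofPred_eq]
    obtain ⟨i, hi⟩ := hI
    exact ⟨fun h => ⟨(h i hi).2, fun j hj => (h j hj).1⟩, fun h j hj => ⟨h.2 j hj, h.1⟩⟩
  rw [hinter, hS]
  exact volume_ratioRegion volume b hx hI'
end
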